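/- Let (f,g,ρ) be a warped Berger solution of Ricci flow on S^1×S^3 defined on [0,T) satisfying Assumption B. Then there exists a uniform constant C < ∞ such that the gradient of the eccentricity satisfies |f_s(ξ,t) − g_s(ξ,t)| ≤ C·M(ξ,t) for all (ξ,t) ∈ S^1×[0,T). -/

import Mathlib

open Real Set Filter Topology

noncomputable section

/-- Partial derivative in the first (spatial, `ξ`) variable. -/
def pd1 (φ : ℝ → ℝ → ℝ) (ξ t : ℝ) : ℝ := deriv (fun x => φ x t) ξ

/-- Partial derivative in the second (time) variable: `φ_t`. -/
def pdt (φ : ℝ → ℝ → ℝ) (ξ t : ℝ) : ℝ := deriv (fun τ => φ ξ τ) t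

/-- Derivative with respect to arclength `s` (where `ds = ρ dξ`): `φ_s := ρ⁻¹ ∂_ξ φ`. -/
def Ds (ρ φ : ℝ → ℝ → ℝ) (ξ t : ℝ) : ℝ := pd1 φ ξ t / ρ ξ t

/-- Sectional curvature `κ₁₂ = κ₃₁ = f²/g⁴ − f_s g_s/(f g)`. -/
def k12 (ρ f g : ℝ → ℝ → ℝ) (ξ t : ℝ) : ℝ :=
  (f ξ t) ^ 2 / (g ξ t) ^ 4 - Ds ρ f ξ t * Ds ρ g ξ t / (f ξ t * g ξ t)

/-- Sectional curvature `κ₃₁ = κ₁₂`. -/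
def k31 (ρ f g : ℝ → ℝ → ℝ) (ξ t : ℝ) : ℝ :=
  (f ξ t) ^ 2 / (g ξ t) ^ 4 - Ds ρ f ξ t * Ds ρ g ξ t / (f ξ t * g ξ t)

/-- Sectional curvature `κ₂₃ = (4g² − 3f²)/g⁴ − g_s²/g²`. -/
def k23 (ρ f g : ℝ → ℝ → ℝ) (ξ t : ℝ) : ℝ :=
  (4 * (g ξ t) ^ 2 - 3 * (f ξ t) ^ 2) / (g ξ t) ^ 4 - (Ds ρ g ξ t) ^ 2 / (g ξ t) ^ 2

/-- Sectional curvature `κ₀₁ = −f_ss/f`. -/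
def k01 (ρ f : ℝ → ℝ → ℝ) (ξ t : ℝ) : ℝ := -(Ds ρ (Ds ρ f) ξ t) / f ξ t

/-- Sectional curvature `κ₀₂ = κ₀₃ = −g_ss/g`. -/
def k02 (ρ g : ℝ → ℝ → ℝ) (ξ t : ℝ) : ℝ := -(Ds ρ (Ds ρ g) ξ t) / g ξ t

/-- Scalar curvature `R = κ₀₁ + 2κ₀₂ + 2κ₁₂ + κ₂₃`. -/
def scalR (ρ f g : ℝ → ℝ → ℝ) (ξ t : ℝ) : ℝ :=
  k01 ρ f ξ t + 2 * k02 ρ g ξ t + 2 * k12 ρ f g ξ t + k23 ρ f g ξ t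

/-- `M(ξ,t) := min {f(ξ,t), g(ξ,t)}`. -/
def M (f g : ℝ → ℝ → ℝ) (ξ t : ℝ) : ℝ := min (f ξ t) (g ξ t)

/-- `M̌(t) := min_{ξ ∈ S¹} M(ξ,t)`. -/
def Mcheck (f g : ℝ → ℝ → ℝ) (t : ℝ) : ℝ := ⨅ ξ : ℝ, M f g ξ t

/-- A warped Berger solution of Ricci flow on `S¹ × S³` with (finite) existence time `T`:
smooth positive `2π`-periodic-in-`ξ` functions `f, g, ρ` on `S¹ × [0,T)` satisfying
  `f_t = f_ss + 2 (g_s/g) f_s − 2 f³/g⁴`,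
  `g_t = g_ss + (f_s/f + g_s/g) g_s + 2 (f² − 2g²)/g³`,
  `(log ρ)_t = f_ss/f + 2 g_ss/g`. -/
structure WarpedBerger (T : ℝ) (f g ρ : ℝ → ℝ → ℝ) : Prop where
  T_pos : 0 < T
  f_pos : ∀ ξ t : ℝ, 0 ≤ t → t < T → 0 < f ξ t
  g_pos : ∀ ξ t : ℝ, 0 ≤ t → t < T → 0 < g ξ t
  ρ_pos : ∀ ξ t : ℝ, 0 ≤ t → t < T → 0 < ρ ξ t
  f_per : ∀ ξ t : ℝ, f (ξ + 2 * π) t = f ξ t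
  g_per : ∀ ξ t : ℝ, g (ξ + 2 * π) t = g ξ t
  ρ_per : ∀ ξ t : ℝ, ρ (ξ + 2 * π) t = ρ ξ t
  smooth : ContDiffOn ℝ (⊤ : ℕ∞)
      (fun p : ℝ × ℝ => (f p.1 p.2, g p.1 p.2, ρ p.1 p.2)) (Set.univ ×ˢ Set.Ico 0 T)
  eq_f : ∀ ξ t : ℝ, 0 < t → t < T →
    pdt f ξ t = Ds ρ (Ds ρ f) ξ t + 2 * (Ds ρ g ξ t / g ξ t) * Ds ρ f ξ t
      - 2 * (f ξ t) ^ 3 / (g ξ t) ^ 4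
  eq_g : ∀ ξ t : ℝ, 0 < t → t < T →
    pdt g ξ t = Ds ρ (Ds ρ g) ξ t
      + (Ds ρ f ξ t / f ξ t + Ds ρ g ξ t / g ξ t) * Ds ρ g ξ t
      + 2 * ((f ξ t) ^ 2 - 2 * (g ξ t) ^ 2) / (g ξ t) ^ 3
  eq_ρ : ∀ ξ t : ℝ, 0 < t → t < T →
    pdt (fun x τ => Real.log (ρ x τ)) ξ t
      = Ds ρ (Ds ρ f) ξ t / f ξ t + 2 * (Ds ρ (Ds ρ g) ξ t / g ξ t)

/-- The Ricci curvature blows up as `t ↗ T`: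
`limsup_{t↗T} max_ξ (|κ₀₁+2κ₁₂| + |κ₀₁+2κ₀₂| + |κ₀₂+κ₁₂+κ₂₃|) = ∞`, where the three
displayed quantities are the diagonal components of the Ricci tensor. -/
def RicciBlowup (T : ℝ) (f g ρ : ℝ → ℝ → ℝ) : Prop :=
  ∀ K : ℝ, ∀ t₀ : ℝ, 0 ≤ t₀ → t₀ < T → ∃ ξ t : ℝ, t₀ < t ∧ t < T ∧
    K < |k01 ρ f ξ t + 2 * k12 ρ f g ξ t| + |k01 ρ f ξ t + 2 * k02 ρ g ξ t|
        + |k02 ρ g ξ t + k12 ρ f g ξ t + k23 ρ f g ξ t|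

/-- Assumption A: `f ≤ g` at `t = 0`; `(min_ξ R(ξ,0))·(max_ξ g(ξ,0)²) > −3`;
and the Ricci curvature blows up at the finite time `T`. -/
structure AssumptionA (T : ℝ) (f g ρ : ℝ → ℝ → ℝ) extends WarpedBerger T f g ρ : Prop where
  init_order : ∀ ξ : ℝ, f ξ 0 ≤ g ξ 0
  init_scalar : (⨅ ξ : ℝ, scalR ρ f g ξ 0) * (⨆ ξ : ℝ, (g ξ 0) ^ 2) > -3
  ricci_blowup : RicciBlowup T f g ρ

/-- Assumption B: Assumption A and, in addition, at `t = 0` one has `f ≥ (1−ε)g` for some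
`ε ∈ (0,1)` with `2(1−ε)⁵ + 4(1−ε)⁴ > 4/3`, and `|f_s| ≤ 1` at `t = 0`. -/
structure AssumptionB (T : ℝ) (f g ρ : ℝ → ℝ → ℝ) extends AssumptionA T f g ρ : Prop where
  init_pinched : ∃ ε : ℝ, 0 < ε ∧ ε < 1 ∧ 2 * (1 - ε) ^ 5 + 4 * (1 - ε) ^ 4 > 4 / 3 ∧
    ∀ ξ : ℝ, (1 - ε) * g ξ 0 ≤ f ξ 0
  init_fs : ∀ ξ : ℝ, |Ds ρ f ξ 0| ≤ 1

/-- Smoothness of a function of `(ξ,t)` on `ℝ × [0,T)`. -/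
def Gd (T : ℝ) (φ : ℝ → ℝ → ℝ) : Prop :=
  ContDiffOn ℝ (⊤ : ℕ∞) (fun p : ℝ × ℝ => φ p.1 p.2) (Set.univ ×ˢ Set.Ico 0 T)

def Per (φ : ℝ → ℝ → ℝ) : Prop := ∀ ξ t : ℝ, φ (ξ + 2 * π) t = φ ξ t

lemma uds (T : ℝ) : UniqueDiffOn ℝ ((Set.univ : Set ℝ) ×ˢ Set.Ico (0 : ℝ) T) :=
  uniqueDiffOn_univ.prod (uniqueDiffOn_Ico 0 T)

lemma Gd.slice {T : ℝ} {φ : ℝ → ℝ → ℝ} (h : Gd T φ) {ξ t : ℝ} (h0 : 0 ≤ t) (h1 : t < T) :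
    HasDerivAt (fun x => φ x t) (fderivWithin ℝ (fun p : ℝ × ℝ => φ p.1 p.2)
      (Set.univ ×ˢ Set.Ico 0 T) (ξ, t) (1, 0)) ξ := by
  have hm : (ξ, t) ∈ (Set.univ : Set ℝ) ×ˢ Set.Ico (0 : ℝ) T := ⟨trivial, h0, h1⟩
  have hd : HasFDerivWithinAt (fun p : ℝ × ℝ => φ p.1 p.2) _ _ (ξ, t) :=
    ((h.differentiableOn (by simp)) (ξ, t) hm).hasFDerivWithinAt
  have hc : HasDerivWithinAt (fun x : ℝ => (x, t)) ((1 : ℝ), (0 : ℝ)) Set.univ ξ :=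
    ((hasDerivAt_id ξ).prodMk (hasDerivAt_const ξ t)).hasDerivWithinAt
  have hmaps : Set.MapsTo (fun x : ℝ => (x, t)) Set.univ ((Set.univ : Set ℝ) ×ˢ Set.Ico (0 : ℝ) T) :=
    fun x _ => ⟨trivial, h0, h1⟩
  have := hd.comp_hasDerivWithinAt ξ hc hmaps
  exact hasDerivWithinAt_univ.1 this

lemma Gd.pd1_eq {T : ℝ} {φ : ℝ → ℝ → ℝ} (h : Gd T φ) {ξ t : ℝ} (h0 : 0 ≤ t) (h1 : t < T) :
    pd1 φ ξ t = fderivWithin ℝ (fun p : ℝ × ℝ => φ p.1 p.2)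
      (Set.univ ×ˢ Set.Ico 0 T) (ξ, t) (1, 0) := (h.slice h0 h1).deriv

lemma Gd.pd1 {T : ℝ} {φ : ℝ → ℝ → ℝ} (h : Gd T φ) : Gd T (pd1 φ) := by
  have := (h.fderivWithin (m := (⊤ : ℕ∞)) (uds T) (by simp)).clm_apply
    (contDiffOn_const (c := ((1 : ℝ), (0 : ℝ))))
  refine this.congr ?_
  rintro ⟨ξ, t⟩ ⟨-, h0, h1⟩
  exact h.pd1_eq h0 h1

lemma Gd.Ds {T : ℝ} {ρ φ : ℝ → ℝ → ℝ} (h : Gd T φ) (hρ : Gd T ρ)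
    (hp : ∀ ξ t : ℝ, 0 ≤ t → t < T → 0 < ρ ξ t) : Gd T (Ds ρ φ) :=
  ContDiffOn.div h.pd1 hρ (fun p hp' => (hp p.1 p.2 hp'.2.1 hp'.2.2).ne')

lemma Gd.hasDx {T : ℝ} {ρ φ : ℝ → ℝ → ℝ} (h : Gd T φ)
    (hp : ∀ ξ t : ℝ, 0 ≤ t → t < T → 0 < ρ ξ t) {ξ t : ℝ} (h0 : 0 ≤ t) (h1 : t < T) :
    HasDerivAt (fun x => φ x t) (ρ ξ t * _root_.Ds ρ φ ξ t) ξ := by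
  have := h.slice (ξ := ξ) h0 h1
  rw [← h.pd1_eq h0 h1] at this
  convert this using 1
  unfold _root_.Ds
  have := (hp ξ t h0 h1).ne'
  field_simp

lemma Ds_of {T : ℝ} {ρ φ : ℝ → ℝ → ℝ}
    (hp : ∀ ξ t : ℝ, 0 ≤ t → t < T → 0 < ρ ξ t) {ξ t d : ℝ} (h0 : 0 ≤ t) (h1 : t < T)
    (h : HasDerivAt (fun x => φ x t) (ρ ξ t * d) ξ) : Ds ρ φ ξ t = d := by
  unfold Ds pd1
  rw [h.deriv]
  have := (hp ξ t h0 h1).ne'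
  field_simp

lemma Gd.cda {T : ℝ} {φ : ℝ → ℝ → ℝ} (h : Gd T φ) {ξ t : ℝ} (h0 : 0 < t) (h1 : t < T) :
    ContDiffAt ℝ (⊤ : ℕ∞) (fun p : ℝ × ℝ => φ p.1 p.2) (ξ, t) :=
  ContDiffOn.contDiffAt h (prod_mem_nhds univ_mem (Ico_mem_nhds h0 h1))

lemma Gd.hasDt' {T : ℝ} {φ : ℝ → ℝ → ℝ} (h : Gd T φ) {ξ t : ℝ} (h0 : 0 < t) (h1 : t < T) :
    HasDerivAt (fun τ => φ ξ τ) (fderiv ℝ (fun p : ℝ × ℝ => φ p.1 p.2) (ξ, t) (0, 1)) t := by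
  have hd := ((h.cda (ξ := ξ) h0 h1).differentiableAt (by simp)).hasFDerivAt
  exact hd.comp_hasDerivAt t ((hasDerivAt_const t ξ).prodMk (hasDerivAt_id t))

lemma Gd.hasDx' {T : ℝ} {φ : ℝ → ℝ → ℝ} (h : Gd T φ) {ξ t : ℝ} (h0 : 0 < t) (h1 : t < T) :
    HasDerivAt (fun x => φ x t) (fderiv ℝ (fun p : ℝ × ℝ => φ p.1 p.2) (ξ, t) (1, 0)) ξ := by
  have hd := ((h.cda (ξ := ξ) h0 h1).differentiableAt (by simp)).hasFDerivAt
  exact hd.comp_hasDerivAt ξ ((hasDerivAt_id ξ).prodMk (hasDerivAt_const ξ t))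

lemma Gd.hasDt {T : ℝ} {φ : ℝ → ℝ → ℝ} (h : Gd T φ) {ξ t : ℝ} (h0 : 0 < t) (h1 : t < T) :
    HasDerivAt (fun τ => φ ξ τ) (pdt φ ξ t) t := by
  have := h.hasDt' (ξ := ξ) h0 h1
  unfold pdt
  rwa [this.deriv]

lemma Gd.mixed {T : ℝ} {φ : ℝ → ℝ → ℝ} (h : Gd T φ) {ξ t : ℝ} (h0 : 0 < t) (h1 : t < T) :
    HasDerivAt (fun x => pdt φ x t) (pdt (_root_.pd1 φ) ξ t) ξ := by
  set F := (fun p : ℝ × ℝ => φ p.1 p.2) with hF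
  have hc := h.cda (ξ := ξ) h0 h1
  have hsym : IsSymmSndFDerivAt ℝ F (ξ, t) := hc.isSymmSndFDerivAt (by
    simp only [minSmoothness_of_isRCLikeNormedField]; exact WithTop.coe_le_coe.2 (le_top : (2 : ℕ∞) ≤ ⊤))
  have hdd : HasFDerivAt (fderiv ℝ F) (fderiv ℝ (fderiv ℝ F) (ξ, t)) (ξ, t) :=
    ((hc.fderiv_right (m := 1) (by norm_cast)).differentiableAt (by simp)).hasFDerivAt
  have e1 : HasDerivAt (fun x => fderiv ℝ F (x, t) (0, 1))
      (fderiv ℝ (fderiv ℝ F) (ξ, t) (1, 0) (0, 1)) ξ := by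
    have := hdd.comp_hasDerivAt ξ ((hasDerivAt_id ξ).prodMk (hasDerivAt_const ξ t))
    exact ((ContinuousLinearMap.apply ℝ ℝ ((0 : ℝ), (1 : ℝ))).hasFDerivAt.comp_hasDerivAt ξ this)
  have e2 : HasDerivAt (fun τ => fderiv ℝ F (ξ, τ) (1, 0))
      (fderiv ℝ (fderiv ℝ F) (ξ, t) (0, 1) (1, 0)) t := by
    have := hdd.comp_hasDerivAt t ((hasDerivAt_const t ξ).prodMk (hasDerivAt_id t))
    exact ((ContinuousLinearMap.apply ℝ ℝ ((1 : ℝ), (0 : ℝ))).hasFDerivAt.comp_hasDerivAt t this)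
  have e3 : pdt (_root_.pd1 φ) ξ t = fderiv ℝ (fderiv ℝ F) (ξ, t) (0, 1) (1, 0) := by
    refine HasDerivAt.deriv (e2.congr_of_eventuallyEq ?_)
    filter_upwards [Ioo_mem_nhds h0 h1] with τ hτ
    exact (h.hasDx' hτ.1 hτ.2).deriv
  have e4 : (fun x => pdt φ x t) = fun x => fderiv ℝ F (x, t) (0, 1) := by
    funext x; exact (h.hasDt' h0 h1).deriv
  rw [e3, e4, ← hsym.eq (1, 0) (0, 1)]
  exact e1

/-- commutator of `∂_t` and `∂_s`. -/
lemma Gd.comm {T : ℝ} {ρ φ : ℝ → ℝ → ℝ} (h : Gd T φ) (hρ : Gd T ρ)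
    (hp : ∀ ξ t : ℝ, 0 ≤ t → t < T → 0 < ρ ξ t) {ξ t d : ℝ} (h0 : 0 < t) (h1 : t < T)
    (hd : HasDerivAt (fun x => pdt φ x t) (ρ ξ t * d) ξ) :
    pdt (_root_.Ds ρ φ) ξ t = d - pdt (fun x τ => Real.log (ρ x τ)) ξ t * _root_.Ds ρ φ ξ t := by
  have hρ0 := (hp ξ t h0.le h1).ne'
  have e1 := (h.mixed (ξ := ξ) h0 h1).unique hd
  have e2 : pdt (fun x τ => Real.log (ρ x τ)) ξ t = pdt ρ ξ t / ρ ξ t :=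
    ((hρ.hasDt h0 h1).log hρ0).deriv
  have e3 : pdt (_root_.Ds ρ φ) ξ t = _ := ((h.pd1.hasDt h0 h1).div (hρ.hasDt (ξ := ξ) h0 h1) hρ0).deriv
  rw [e3, e2, e1]
  unfold _root_.Ds
  field_simp

lemma Per.pd1 {φ : ℝ → ℝ → ℝ} (h : Per φ) : Per (pd1 φ) := by
  intro ξ t
  unfold _root_.pd1
  rw [← deriv_comp_add_const]
  congr 1
  funext x
  exact h x t

lemma Per.Ds {ρ φ : ℝ → ℝ → ℝ} (h : Per φ) (hρ : Per ρ) : Per (Ds ρ φ) := by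
  intro ξ t
  unfold _root_.Ds
  rw [h.pd1, hρ]

lemma Per.rep {φ : ℝ → ℝ → ℝ} (h : Per φ) (ξ : ℝ) :
    ∃ x ∈ Set.Icc 0 (2 * π), ∀ t, φ x t = φ ξ t := by
  have hper : Function.Periodic (fun x => (fun t => φ x t)) (2 * π) := by
    intro x; funext t; exact h x t
  obtain ⟨y, hy, e⟩ := hper.exists_mem_Ico₀ (by positivity) ξ
  exact ⟨y, ⟨hy.1, hy.2.le⟩, fun t => (congrFun e t).symm⟩

lemma Gd.bdd {T : ℝ} (hT : 0 < T) {φ : ℝ → ℝ → ℝ} (h : Gd T φ) (hper : Per φ) :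
    ∃ K, ∀ ξ, φ ξ 0 ≤ K := by
  have hc : ContinuousOn (fun x => φ x 0) (Set.Icc 0 (2 * π)) :=
    fun x _ => (h.slice le_rfl hT).continuousAt.continuousWithinAt
  obtain ⟨K, hK⟩ := (isCompact_Icc.image_of_continuousOn hc).bddAbove
  refine ⟨K, fun ξ => ?_⟩
  obtain ⟨x, hx, e⟩ := hper.rep ξ
  rw [← e]
  exact hK ⟨x, hx, rfl⟩

/-- maximum principle -/
lemma MP {T : ℝ} {ρ φ : ℝ → ℝ → ℝ} (h : Gd T φ) (hρ : Gd T ρ)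
    (hp : ∀ ξ t : ℝ, 0 ≤ t → t < T → 0 < ρ ξ t) (hper : Per φ)
    (hi : ∀ ξ, φ ξ 0 ≤ 0)
    (H : ∀ ξ t, 0 < t → t < T → 0 < φ ξ t → Ds ρ φ ξ t = 0 → Ds ρ (Ds ρ φ) ξ t ≤ 0 →
      pdt φ ξ t ≤ 0) :
    ∀ ξ t, 0 ≤ t → t < T → φ ξ t ≤ 0 := by
  intro ξ₀ t₀ ht0 htT
  by_contra! hpos
  have ht0' : 0 < t₀ := by
    rcases ht0.eq_or_lt with e | e
    · subst e; linarith [hi ξ₀]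
    · exact e
  set δ := φ ξ₀ t₀ / (2 * t₀) with hδ
  have hδ0 : 0 < δ := by positivity
  have hδt : δ * t₀ < φ ξ₀ t₀ := by rw [hδ]; field_simp; linarith
  have hcont : ContinuousOn (fun p : ℝ × ℝ => φ p.1 p.2 - δ * p.2)
      (Set.Icc 0 (2 * π) ×ˢ Set.Icc 0 t₀) := by
    refine ContinuousOn.sub (h.continuousOn.mono ?_) (by fun_prop)
    exact Set.prod_mono (Set.subset_univ _) (fun x hx => ⟨hx.1, hx.2.trans_lt htT⟩)
  obtain ⟨x₀, hx₀, e₀⟩ := hper.rep ξ₀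
  obtain ⟨⟨x₁, t₁⟩, ⟨hx₁, ht₁⟩, hmax⟩ := (isCompact_Icc.prod isCompact_Icc).exists_isMaxOn
    ⟨(x₀, t₀), hx₀, ht0, le_rfl⟩ hcont
  simp only at hx₁ ht₁
  have hmax' : ∀ x t, 0 ≤ t → t ≤ t₀ → φ x t - δ * t ≤ φ x₁ t₁ - δ * t₁ := by
    intro x t h1 h2
    obtain ⟨y, hy, e⟩ := hper.rep x
    rw [← e]
    exact hmax (a := (y, t)) ⟨hy, h1, h2⟩
  have hv : 0 < φ x₁ t₁ - δ * t₁ := by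
    have := hmax' ξ₀ t₀ ht0 le_rfl
    linarith
  have ht₁0 : 0 < t₁ := by
    rcases ht₁.1.eq_or_lt with e | e
    · rw [← e] at hv; linarith [hi x₁]
    · exact e
  have ht₁T : t₁ < T := ht₁.2.trans_lt htT
  have hφ : 0 < φ x₁ t₁ := by nlinarith
  have hsp : ∀ x, φ x t₁ ≤ φ x₁ t₁ := by
    intro x; have := hmax' x t₁ ht₁.1 ht₁.2; linarith
  have hlm : IsLocalMax (fun x => φ x t₁) x₁ := Filter.Eventually.of_forall hsp
  have hd0 : deriv (fun x => φ x t₁) x₁ = 0 := hlm.deriv_eq_zero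
  have hD1 : Ds ρ φ x₁ t₁ = 0 := by
    unfold Ds pd1; rw [hd0]; simp
  have hdd : deriv (deriv (fun x => φ x t₁)) x₁ ≤ 0 := by
    by_contra! hc
    have hmin := isLocalMin_of_deriv_deriv_pos hc hd0 (h.slice ht₁.1 ht₁T).continuousAt
    have hcst : (fun x => φ x t₁) =ᶠ[𝓝 x₁] fun _ => φ x₁ t₁ := by
      filter_upwards [hmin] with x hx
      exact le_antisymm (hsp x) hx
    have := hcst.deriv.deriv_eq
    rw [this] at hc
    simp at hc
  have hD2 : Ds ρ (Ds ρ φ) x₁ t₁ ≤ 0 := by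
    have hρ0 := hp x₁ t₁ ht₁.1 ht₁T
    have e : pd1 (Ds ρ φ) x₁ t₁ = _ :=
      ((h.pd1.slice (ξ := x₁) ht₁.1 ht₁T).div (hρ.slice ht₁.1 ht₁T) hρ0.ne').deriv
    have e2 : pd1 φ x₁ t₁ = 0 := hd0
    have e3 : pd1 (pd1 φ) x₁ t₁ ≤ 0 := hdd
    rw [← h.pd1.pd1_eq ht₁.1 ht₁T, e2] at e
    have : Ds ρ (Ds ρ φ) x₁ t₁ = pd1 (Ds ρ φ) x₁ t₁ / ρ x₁ t₁ := rfl
    rw [this, e]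
    refine div_nonpos_of_nonpos_of_nonneg (div_nonpos_of_nonpos_of_nonneg ?_ (by positivity)) hρ0.le
    have := mul_nonpos_of_nonpos_of_nonneg e3 hρ0.le
    linarith
  have key := H x₁ t₁ ht₁0 ht₁T hφ hD1 hD2
  have hdt : HasDerivWithinAt (fun τ => φ x₁ τ - δ * τ) (pdt φ x₁ t₁ - δ) (Set.Iio t₁) t₁ := by
    have := (h.hasDt (ξ := x₁) ht₁0 ht₁T).sub ((hasDerivAt_id t₁).const_mul δ)
    exact (this.congr_deriv (by simp)).hasDerivWithinAt
  have hsl := (hasDerivWithinAt_iff_tendsto_slope' (by simp)).1 hdt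
  have : 0 ≤ pdt φ x₁ t₁ - δ := by
    refine ge_of_tendsto hsl ?_
    filter_upwards [Ioo_mem_nhdsLT ht₁0] with τ hτ
    have := hmax' x₁ τ hτ.1.le (hτ.2.le.trans ht₁.2)
    rw [slope_def_field]
    exact div_nonneg_of_nonpos (by linarith) (by linarith [hτ.2])
  linarith

/-- maximum principle for squares -/
lemma MPsq {T : ℝ} {ρ φ : ℝ → ℝ → ℝ} (K : ℝ) (h : Gd T φ) (hρ : Gd T ρ)
    (hp : ∀ ξ t : ℝ, 0 ≤ t → t < T → 0 < ρ ξ t) (hper : Per φ) (hK : 0 ≤ K)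
    (hi : ∀ ξ, φ ξ 0 ^ 2 ≤ K)
    (H : ∀ ξ t, 0 < t → t < T → K < φ ξ t ^ 2 → Ds ρ φ ξ t = 0 →
      φ ξ t * Ds ρ (Ds ρ φ) ξ t ≤ 0 → φ ξ t * pdt φ ξ t ≤ 0) :
    ∀ ξ t, 0 ≤ t → t < T → φ ξ t ^ 2 ≤ K := by
  have main := MP (φ := fun ξ t => φ ξ t ^ 2 - K) (ContDiffOn.sub (ContDiffOn.pow h 2) contDiffOn_const)
    hρ hp (fun ξ t => by simp only [hper ξ t]) (fun ξ => by linarith [hi ξ]) ?_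
  · intro ξ t h0 h1; linarith [main ξ t h0 h1]
  intro ξ t h0 h1 hpos hs hss
  have hsl : ∀ x, Ds ρ (fun ξ t => φ ξ t ^ 2 - K) x t = 2 * φ x t * Ds ρ φ x t := by
    intro x
    refine Ds_of hp h0.le h1 ?_
    exact (((h.hasDx hp (ξ := x) h0.le h1).pow 2).sub_const K).congr_deriv (by norm_num; ring)
  have hss' : Ds ρ (Ds ρ (fun ξ t => φ ξ t ^ 2 - K)) ξ t
      = 2 * Ds ρ φ ξ t ^ 2 + 2 * φ ξ t * Ds ρ (Ds ρ φ) ξ t := by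
    refine Ds_of hp h0.le h1 ?_
    rw [show (fun x => Ds ρ (fun ξ t => φ ξ t ^ 2 - K) x t) = _ from funext hsl]
    exact (((h.hasDx hp (ξ := ξ) h0.le h1).const_mul 2).mul
      ((h.Ds hρ hp).hasDx hp h0.le h1)).congr_deriv (by ring)
  have ht : pdt (fun ξ t => φ ξ t ^ 2 - K) ξ t = 2 * (φ ξ t * pdt φ ξ t) := by
    have := (((h.hasDt (ξ := ξ) h0 h1).pow 2).sub_const K).deriv
    unfold pdt at this ⊢
    refine this.trans ?_
    norm_num; ring
  rw [ht]
  rw [hsl] at hs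
  have hφ : φ ξ t ≠ 0 := by
    intro e
    rw [e] at hpos; simp at hpos; linarith
  have hs0 : Ds ρ φ ξ t = 0 := by
    rcases mul_eq_zero.1 hs with e | e
    · exact absurd (by linarith) hφ
    · exact e
  rw [hss', hs0] at hss
  have := H ξ t h0 h1 (by linarith) hs0 (by linarith)
  linarith

section evo
variable {T : ℝ} {f g ρ : ℝ → ℝ → ℝ}

lemma WarpedBerger.gf (s : WarpedBerger T f g ρ) : Gd T f := ContDiffOn.fst s.smooth
lemma WarpedBerger.gg (s : WarpedBerger T f g ρ) : Gd T g := ContDiffOn.fst (ContDiffOn.snd s.smooth)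
lemma WarpedBerger.gr (s : WarpedBerger T f g ρ) : Gd T ρ := ContDiffOn.snd (ContDiffOn.snd s.smooth)

lemma WarpedBerger.evo_fs (s : WarpedBerger T f g ρ) {ξ t : ℝ} (h0 : 0 < t) (h1 : t < T) :
    pdt (Ds ρ f) ξ t = Ds ρ (Ds ρ (Ds ρ f)) ξ t
      + (2 * Ds ρ g ξ t / g ξ t - Ds ρ f ξ t / f ξ t) * Ds ρ (Ds ρ f) ξ t
      - (2 * Ds ρ g ξ t ^ 2 / g ξ t ^ 2 + 6 * f ξ t ^ 2 / g ξ t ^ 4) * Ds ρ f ξ t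
      + 8 * f ξ t ^ 3 * Ds ρ g ξ t / g ξ t ^ 5 := by
  have hp := s.ρ_pos
  have hg0 := (s.g_pos ξ t h0.le h1).ne'
  have hf0 := (s.f_pos ξ t h0.le h1).ne'
  have d0f := s.gf.hasDx hp (ξ := ξ) h0.le h1
  have d0g := s.gg.hasDx hp (ξ := ξ) h0.le h1
  have d1f := (s.gf.Ds s.gr hp).hasDx hp (ξ := ξ) h0.le h1
  have d1g := (s.gg.Ds s.gr hp).hasDx hp (ξ := ξ) h0.le h1
  have d2f := ((s.gf.Ds s.gr hp).Ds s.gr hp).hasDx hp (ξ := ξ) h0.le h1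
  have hd : HasDerivAt (fun x => pdt f x t) (ρ ξ t * (Ds ρ (Ds ρ (Ds ρ f)) ξ t
      + 2 * ((Ds ρ (Ds ρ g) ξ t / g ξ t - Ds ρ g ξ t ^ 2 / g ξ t ^ 2) * Ds ρ f ξ t
        + Ds ρ g ξ t / g ξ t * Ds ρ (Ds ρ f) ξ t)
      - 2 * (3 * f ξ t ^ 2 * Ds ρ f ξ t / g ξ t ^ 4 - 4 * f ξ t ^ 3 * Ds ρ g ξ t / g ξ t ^ 5))) ξ := by
    rw [show (fun x => pdt f x t) = _ from funext fun x => s.eq_f x t h0 h1]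
    refine ((d2f.add (((d1g.div d0g hg0).const_mul 2).mul d1f)).sub
      (((d0f.pow 3).const_mul 2).div (d0g.pow 4) (pow_ne_zero 4 hg0))).congr_deriv ?_
    simp only [Pi.div_apply, Pi.pow_apply]
    field_simp
    ring
  rw [s.gf.comm s.gr hp h0 h1 hd, s.eq_ρ ξ t h0 h1]
  field_simp
  ring

lemma WarpedBerger.evo_gs (s : WarpedBerger T f g ρ) {ξ t : ℝ} (h0 : 0 < t) (h1 : t < T) :
    pdt (Ds ρ g) ξ t = Ds ρ (Ds ρ (Ds ρ g)) ξ t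
      + Ds ρ f ξ t / f ξ t * Ds ρ (Ds ρ g) ξ t
      - (Ds ρ f ξ t ^ 2 / f ξ t ^ 2 + Ds ρ g ξ t ^ 2 / g ξ t ^ 2 + 6 * f ξ t ^ 2 / g ξ t ^ 4
          - 4 / g ξ t ^ 2) * Ds ρ g ξ t
      + 4 * f ξ t * Ds ρ f ξ t / g ξ t ^ 3 := by
  have hp := s.ρ_pos
  have hg0 := (s.g_pos ξ t h0.le h1).ne'
  have hf0 := (s.f_pos ξ t h0.le h1).ne'
  have d0f := s.gf.hasDx hp (ξ := ξ) h0.le h1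
  have d0g := s.gg.hasDx hp (ξ := ξ) h0.le h1
  have d1f := (s.gf.Ds s.gr hp).hasDx hp (ξ := ξ) h0.le h1
  have d1g := (s.gg.Ds s.gr hp).hasDx hp (ξ := ξ) h0.le h1
  have d2g := ((s.gg.Ds s.gr hp).Ds s.gr hp).hasDx hp (ξ := ξ) h0.le h1
  have hd : HasDerivAt (fun x => pdt g x t) (ρ ξ t * (Ds ρ (Ds ρ (Ds ρ g)) ξ t
      + (Ds ρ (Ds ρ f) ξ t / f ξ t - Ds ρ f ξ t ^ 2 / f ξ t ^ 2
          + Ds ρ (Ds ρ g) ξ t / g ξ t - Ds ρ g ξ t ^ 2 / g ξ t ^ 2) * Ds ρ g ξ t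
      + (Ds ρ f ξ t / f ξ t + Ds ρ g ξ t / g ξ t) * Ds ρ (Ds ρ g) ξ t
      + 4 * f ξ t * Ds ρ f ξ t / g ξ t ^ 3 - 6 * f ξ t ^ 2 * Ds ρ g ξ t / g ξ t ^ 4
      + 4 * Ds ρ g ξ t / g ξ t ^ 2)) ξ := by
    rw [show (fun x => pdt g x t) = _ from funext fun x => s.eq_g x t h0 h1]
    refine ((d2g.add (((d1f.div d0f hf0).add (d1g.div d0g hg0)).mul d1g)).add
      ((((d0f.pow 2).sub ((d0g.pow 2).const_mul 2)).const_mul 2).div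
        (d0g.pow 3) (pow_ne_zero 3 hg0))).congr_deriv ?_
    simp only [Pi.div_apply, Pi.pow_apply, Pi.add_apply, Pi.sub_apply]
    field_simp
    ring
  rw [s.gg.comm s.gr hp h0 h1 hd, s.eq_ρ ξ t h0 h1]
  field_simp
  ring

/-- `w = log f - log g` -/
def ww (f g : ℝ → ℝ → ℝ) (ξ t : ℝ) : ℝ := Real.log (f ξ t) - Real.log (g ξ t)

lemma WarpedBerger.gw (s : WarpedBerger T f g ρ) : Gd T (ww f g) :=
  ContDiffOn.sub (ContDiffOn.log s.gf fun p hp => (s.f_pos _ _ hp.2.1 hp.2.2).ne')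
    (ContDiffOn.log s.gg fun p hp => (s.g_pos _ _ hp.2.1 hp.2.2).ne')

lemma WarpedBerger.pw (s : WarpedBerger T f g ρ) : Per (ww f g) := by
  intro ξ t; unfold ww; rw [s.f_per, s.g_per]

lemma WarpedBerger.ws (s : WarpedBerger T f g ρ) (ξ : ℝ) {t : ℝ} (h0 : 0 ≤ t) (h1 : t < T) :
    Ds ρ (ww f g) ξ t = Ds ρ f ξ t / f ξ t - Ds ρ g ξ t / g ξ t := by
  have hp := s.ρ_pos
  refine Ds_of hp h0 h1 ?_
  refine (((s.gf.hasDx hp (ξ := ξ) h0 h1).log (s.f_pos _ _ h0 h1).ne').sub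
    ((s.gg.hasDx hp (ξ := ξ) h0 h1).log (s.g_pos _ _ h0 h1).ne')).congr_deriv ?_
  ring

lemma WarpedBerger.wss (s : WarpedBerger T f g ρ) (ξ : ℝ) {t : ℝ} (h0 : 0 ≤ t) (h1 : t < T) :
    Ds ρ (Ds ρ (ww f g)) ξ t = Ds ρ (Ds ρ f) ξ t / f ξ t - Ds ρ f ξ t ^ 2 / f ξ t ^ 2
      - Ds ρ (Ds ρ g) ξ t / g ξ t + Ds ρ g ξ t ^ 2 / g ξ t ^ 2 := by
  have hp := s.ρ_pos
  have hg0 := (s.g_pos ξ t h0 h1).ne'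
  have hf0 := (s.f_pos ξ t h0 h1).ne'
  refine Ds_of hp h0 h1 ?_
  rw [show (fun x => Ds ρ (ww f g) x t) = _ from funext fun x => s.ws x h0 h1]
  refine ((((s.gf.Ds s.gr hp).hasDx hp (ξ := ξ) h0 h1).div (s.gf.hasDx hp (ξ := ξ) h0 h1) hf0).sub
    (((s.gg.Ds s.gr hp).hasDx hp (ξ := ξ) h0 h1).div (s.gg.hasDx hp (ξ := ξ) h0 h1) hg0)).congr_deriv ?_
  field_simp
  ring

lemma WarpedBerger.wt (s : WarpedBerger T f g ρ) (ξ : ℝ) {t : ℝ} (h0 : 0 < t) (h1 : t < T) :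
    pdt (ww f g) ξ t = Ds ρ (Ds ρ (ww f g)) ξ t
      + (Ds ρ f ξ t / f ξ t + 2 * (Ds ρ g ξ t / g ξ t)) * Ds ρ (ww f g) ξ t
      + 4 * (g ξ t ^ 2 - f ξ t ^ 2) / g ξ t ^ 4 := by
  have hg0 := (s.g_pos ξ t h0.le h1).ne'
  have hf0 := (s.f_pos ξ t h0.le h1).ne'
  have e : pdt (ww f g) ξ t = pdt f ξ t / f ξ t - pdt g ξ t / g ξ t :=
    (((s.gf.hasDt (ξ := ξ) h0 h1).log hf0).sub ((s.gg.hasDt (ξ := ξ) h0 h1).log hg0)).deriv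
  rw [e, s.wss ξ h0.le h1, s.ws ξ h0.le h1, s.eq_f ξ t h0 h1, s.eq_g ξ t h0 h1]
  field_simp
  ring

lemma WarpedBerger.evo_V (s : WarpedBerger T f g ρ) {ξ t : ℝ} (h0 : 0 < t) (h1 : t < T) :
    pdt (Ds ρ (ww f g)) ξ t = Ds ρ (Ds ρ (Ds ρ (ww f g))) ξ t
      + (Ds ρ f ξ t / f ξ t + 2 * (Ds ρ g ξ t / g ξ t)) * Ds ρ (Ds ρ (ww f g)) ξ t
      - (Ds ρ f ξ t ^ 2 / f ξ t ^ 2 + 2 * Ds ρ g ξ t ^ 2 / g ξ t ^ 2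
          + 8 * f ξ t ^ 2 / g ξ t ^ 4) * Ds ρ (ww f g) ξ t
      - 8 * (g ξ t ^ 2 - f ξ t ^ 2) * Ds ρ g ξ t / g ξ t ^ 5 := by
  have hp := s.ρ_pos
  have hg0 := (s.g_pos ξ t h0.le h1).ne'
  have hf0 := (s.f_pos ξ t h0.le h1).ne'
  have d0f := s.gf.hasDx hp (ξ := ξ) h0.le h1
  have d0g := s.gg.hasDx hp (ξ := ξ) h0.le h1
  have d1f := (s.gf.Ds s.gr hp).hasDx hp (ξ := ξ) h0.le h1
  have d1g := (s.gg.Ds s.gr hp).hasDx hp (ξ := ξ) h0.le h1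
  have d1w := (s.gw.Ds s.gr hp).hasDx hp (ξ := ξ) h0.le h1
  have d2w := ((s.gw.Ds s.gr hp).Ds s.gr hp).hasDx hp (ξ := ξ) h0.le h1
  have hd : HasDerivAt (fun x => pdt (ww f g) x t) (ρ ξ t * (Ds ρ (Ds ρ (Ds ρ (ww f g))) ξ t
      + (Ds ρ (Ds ρ f) ξ t / f ξ t - Ds ρ f ξ t ^ 2 / f ξ t ^ 2
          + 2 * (Ds ρ (Ds ρ g) ξ t / g ξ t - Ds ρ g ξ t ^ 2 / g ξ t ^ 2)) * Ds ρ (ww f g) ξ t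
      + (Ds ρ f ξ t / f ξ t + 2 * (Ds ρ g ξ t / g ξ t)) * Ds ρ (Ds ρ (ww f g)) ξ t
      + 4 * (2 * g ξ t * Ds ρ g ξ t - 2 * f ξ t * Ds ρ f ξ t) / g ξ t ^ 4
      - 16 * (g ξ t ^ 2 - f ξ t ^ 2) * Ds ρ g ξ t / g ξ t ^ 5)) ξ := by
    rw [show (fun x => pdt (ww f g) x t) = _ from funext fun x => s.wt x h0 h1]
    refine ((d2w.add (((d1f.div d0f hf0).add ((d1g.div d0g hg0).const_mul 2)).mul d1w)).add
      ((((d0g.pow 2).sub (d0f.pow 2)).const_mul 4).div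
        (d0g.pow 4) (pow_ne_zero 4 hg0))).congr_deriv ?_
    simp only [Pi.div_apply, Pi.pow_apply, Pi.add_apply, Pi.sub_apply]
    field_simp
    ring
  rw [s.gw.comm s.gr hp h0 h1 hd, s.eq_ρ ξ t h0 h1, s.ws ξ h0.le h1]
  field_simp
  ring

/-- `f ≤ g` is preserved. -/
lemma WarpedBerger.ord (s : WarpedBerger T f g ρ) (hi : ∀ ξ, f ξ 0 ≤ g ξ 0) :
    ∀ ξ t, 0 ≤ t → t < T → f ξ t ≤ g ξ t := by
  have main := MP s.gw s.gr s.ρ_pos s.pw (fun ξ => by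
    have := Real.log_le_log (s.f_pos ξ 0 le_rfl s.T_pos) (hi ξ)
    unfold ww; linarith) ?_
  · intro ξ t h0 h1
    have := main ξ t h0 h1
    unfold ww at this
    exact (Real.log_le_log_iff (s.f_pos ξ t h0 h1) (s.g_pos ξ t h0 h1)).1 (by linarith)
  intro ξ t h0 h1 hpos hs hss
  have hg := s.g_pos ξ t h0.le h1
  have hf := s.f_pos ξ t h0.le h1
  have hgf : g ξ t < f ξ t := by
    unfold ww at hpos
    exact (Real.log_lt_log_iff hg hf).1 (by linarith)
  rw [s.wt ξ h0 h1, hs]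
  have : 4 * (g ξ t ^ 2 - f ξ t ^ 2) / g ξ t ^ 4 ≤ 0 :=
    div_nonpos_of_nonpos_of_nonneg (by nlinarith) (by positivity)
  linarith

/-- `f ≥ c g` is preserved. -/
lemma WarpedBerger.pinch (s : WarpedBerger T f g ρ) {c : ℝ} (hc : 0 < c) (hc1 : c < 1)
    (hi : ∀ ξ, c * g ξ 0 ≤ f ξ 0) :
    ∀ ξ t, 0 ≤ t → t < T → c * g ξ t ≤ f ξ t := by
  have hp := s.ρ_pos
  have main := MP (φ := fun ξ t => Real.log c - ww f g ξ t) (ContDiffOn.sub contDiffOn_const s.gw)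
    s.gr s.ρ_pos (fun ξ t => by simp only [s.pw ξ t]) (fun ξ => by
    have hg := s.g_pos ξ 0 le_rfl s.T_pos
    have := Real.log_le_log (by positivity) (hi ξ)
    rw [Real.log_mul hc.ne' hg.ne'] at this
    unfold ww; linarith) ?_
  · intro ξ t h0 h1
    have := main ξ t h0 h1
    have hg := s.g_pos ξ t h0 h1
    unfold ww at this
    refine (Real.log_le_log_iff (by positivity) (s.f_pos ξ t h0 h1)).1 ?_
    rw [Real.log_mul hc.ne' hg.ne']
    linarith
  intro ξ t h0 h1 hpos hs hss
  have hg := s.g_pos ξ t h0.le h1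
  have hf := s.f_pos ξ t h0.le h1
  have hgf : f ξ t < g ξ t := by
    have := Real.log_neg hc hc1
    unfold ww at hpos
    exact (Real.log_lt_log_iff hf hg).1 (by linarith)
  have e1 : ∀ x, Ds ρ (fun ξ t => Real.log c - ww f g ξ t) x t = - Ds ρ (ww f g) x t := fun x =>
    Ds_of hp h0.le h1 (((s.gw.hasDx hp (ξ := x) h0.le h1).const_sub _).congr_deriv (by ring))
  have e2 : Ds ρ (Ds ρ (fun ξ t => Real.log c - ww f g ξ t)) ξ t = - Ds ρ (Ds ρ (ww f g)) ξ t := by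
    refine Ds_of hp h0.le h1 ?_
    rw [show (fun x => Ds ρ (fun ξ t => Real.log c - ww f g ξ t) x t) = _ from funext e1]
    exact (((s.gw.Ds s.gr hp).hasDx hp (ξ := ξ) h0.le h1).neg).congr_deriv (by ring)
  have e3 : pdt (fun ξ t => Real.log c - ww f g ξ t) ξ t = - pdt (ww f g) ξ t :=
    ((s.gw.hasDt (ξ := ξ) h0 h1).const_sub _).deriv
  rw [e1] at hs
  rw [e2] at hss
  rw [e3, s.wt ξ h0 h1, neg_eq_zero.1 hs]
  have : 0 ≤ 4 * (g ξ t ^ 2 - f ξ t ^ 2) / g ξ t ^ 4 := by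
    have : 0 ≤ g ξ t ^ 2 - f ξ t ^ 2 := by nlinarith
    positivity
  linarith

lemma alg_fs {f g a b : ℝ} (hf : 0 < f) (hg : 0 < g) (hfg : f ≤ g) (ha : 4 / 3 < a ^ 2) :
    a * (- (2 * b ^ 2 / g ^ 2 + 6 * f ^ 2 / g ^ 4) * a + 8 * f ^ 3 * b / g ^ 5) ≤ 0 := by
  have e : a * (- (2 * b ^ 2 / g ^ 2 + 6 * f ^ 2 / g ^ 4) * a + 8 * f ^ 3 * b / g ^ 5)
      = -(2 * (a * b / g - 2 * f ^ 3 / g ^ 4) ^ 2 + f ^ 2 / g ^ 8 * (6 * a ^ 2 * g ^ 4 - 8 * f ^ 4)) := by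
    field_simp; ring
  rw [e]
  have h4 : f ^ 4 ≤ g ^ 4 := by gcongr
  have : 0 ≤ 6 * a ^ 2 * g ^ 4 - 8 * f ^ 4 := by
    have : 0 < g ^ 4 := by positivity
    nlinarith
  have : 0 ≤ f ^ 2 / g ^ 8 * (6 * a ^ 2 * g ^ 4 - 8 * f ^ 4) := by positivity
  nlinarith [sq_nonneg (a * b / g - 2 * f ^ 3 / g ^ 4)]

lemma WarpedBerger.fs_bd (s : WarpedBerger T f g ρ)
    (hfg : ∀ ξ t, 0 ≤ t → t < T → f ξ t ≤ g ξ t) (hi : ∀ ξ, |Ds ρ f ξ 0| ≤ 1) :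
    ∀ ξ t, 0 ≤ t → t < T → Ds ρ f ξ t ^ 2 ≤ 4 / 3 := by
  refine MPsq (4 / 3) (s.gf.Ds s.gr s.ρ_pos) s.gr s.ρ_pos (Per.Ds s.f_per s.ρ_per) (by norm_num) ?_ ?_
  · intro ξ
    have := (sq_le_one_iff_abs_le_one _).2 (hi ξ)
    linarith
  intro ξ t h0 h1 hpos hs hss
  rw [s.evo_fs h0 h1, hs]
  have := alg_fs (b := Ds ρ g ξ t) (s.f_pos ξ t h0.le h1) (s.g_pos ξ t h0.le h1) (hfg ξ t h0.le h1) hpos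
  linarith

lemma alg_gs {f g a b K : ℝ} (hf : 0 < f) (hg : 0 < g) (hfg : f ≤ g) (hK : 4 ≤ K) (hb : K < b ^ 2) :
    b * (- (a ^ 2 / f ^ 2 + b ^ 2 / g ^ 2 + 6 * f ^ 2 / g ^ 4 - 4 / g ^ 2) * b
      + 4 * f * a / g ^ 3) ≤ 0 := by
  have e : b * (- (a ^ 2 / f ^ 2 + b ^ 2 / g ^ 2 + 6 * f ^ 2 / g ^ 4 - 4 / g ^ 2) * b
      + 4 * f * a / g ^ 3)
      = -((a * b / f - 2 * f ^ 2 / g ^ 3) ^ 2 + b ^ 2 / g ^ 2 * (b ^ 2 - 4)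
        + f ^ 2 / g ^ 6 * (6 * b ^ 2 * g ^ 2 - 4 * f ^ 2)) := by
    field_simp; ring
  rw [e]
  have h4 : f ^ 2 ≤ g ^ 2 := by gcongr
  have : 0 ≤ 6 * b ^ 2 * g ^ 2 - 4 * f ^ 2 := by
    have : 0 < g ^ 2 := by positivity
    nlinarith
  have h1 : 0 ≤ f ^ 2 / g ^ 6 * (6 * b ^ 2 * g ^ 2 - 4 * f ^ 2) := by positivity
  have : 0 ≤ b ^ 2 - 4 := by linarith
  have h2 : 0 ≤ b ^ 2 / g ^ 2 * (b ^ 2 - 4) := by positivity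
  nlinarith [sq_nonneg (a * b / f - 2 * f ^ 2 / g ^ 3)]

lemma Gd.bddsq (hT : 0 < T) {φ : ℝ → ℝ → ℝ} (h : Gd T φ) (hper : Per φ) :
    ∃ K, ∀ ξ, φ ξ 0 ^ 2 ≤ K :=
  Gd.bdd (φ := fun ξ t => φ ξ t ^ 2) hT (ContDiffOn.pow h 2) (fun ξ t => by simp only [hper ξ t])

lemma WarpedBerger.gs_bd (s : WarpedBerger T f g ρ)
    (hfg : ∀ ξ t, 0 ≤ t → t < T → f ξ t ≤ g ξ t) :
    ∃ K, ∀ ξ t, 0 ≤ t → t < T → Ds ρ g ξ t ^ 2 ≤ K := by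
  have hG := s.gg.Ds s.gr s.ρ_pos
  have hP : Per (Ds ρ g) := Per.Ds s.g_per s.ρ_per
  obtain ⟨K, hK⟩ := hG.bddsq s.T_pos hP
  refine ⟨max 4 K, MPsq (max 4 K) hG s.gr s.ρ_pos hP (le_trans (by norm_num) (le_max_left _ _))
    (fun ξ => (hK ξ).trans (le_max_right _ _)) ?_⟩
  intro ξ t h0 h1 hpos hs hss
  rw [s.evo_gs h0 h1, hs]
  have := alg_gs (a := Ds ρ f ξ t) (s.f_pos ξ t h0.le h1) (s.g_pos ξ t h0.le h1) (hfg ξ t h0.le h1)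
    (le_max_left 4 K) hpos
  linarith

lemma alg_N {f g a b c A B : ℝ} (hf : 0 < f) (hg : 0 < g) (hfg : f ≤ g) (hc : 0 < c)
    (hcc : 2 * c ^ 5 + 4 * c ^ 4 > 4 / 3) (hcg : c * g ≤ f)
    (ha : a ^ 2 ≤ 4 / 3) (hs : -a / f ^ 2 + b / g ^ 2 = 0)
    (hss : -A / f ^ 2 + 2 * a ^ 2 / f ^ 3 + B / g ^ 2 - 2 * b ^ 2 / g ^ 3 ≤ 0) :
    -(A + 2 * (b / g) * a - 2 * f ^ 3 / g ^ 4) / f ^ 2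
      + (B + (a / f + b / g) * b + 2 * (f ^ 2 - 2 * g ^ 2) / g ^ 3) / g ^ 2 ≤ 0 := by
  obtain ⟨u, rfl⟩ : ∃ u, f = u * g := ⟨f / g, by field_simp⟩
  have hu : 0 < u := by by_contra! h; nlinarith
  have hcu : c ≤ u := le_of_mul_le_mul_right hcg hg
  have hu1 : u ≤ 1 := by by_contra! h; nlinarith
  have hab : a = u ^ 2 * b := by
    field_simp at hs; linarith
  subst hab
  have hu5 : 2 * c ^ 5 + 4 * c ^ 4 ≤ 2 * u ^ 5 + 4 * u ^ 4 := by gcongr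
  have hb : b ^ 2 ≤ 2 * u + 4 := by
    have h4 : 0 < u ^ 4 := by positivity
    by_contra! hb
    nlinarith
  have e : -(A + 2 * (b / g) * (u ^ 2 * b) - 2 * (u * g) ^ 3 / g ^ 4) / (u * g) ^ 2
      + (B + (u ^ 2 * b / (u * g) + b / g) * b + 2 * ((u * g) ^ 2 - 2 * g ^ 2) / g ^ 3) / g ^ 2
      = (-A / (u * g) ^ 2 + 2 * (u ^ 2 * b) ^ 2 / (u * g) ^ 3 + B / g ^ 2 - 2 * b ^ 2 / g ^ 3)
        - (1 - u) * (2 * u + 4 - b ^ 2) / g ^ 3 := by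
    field_simp; ring
  rw [e]
  have h1 : 0 ≤ 1 - u := by linarith
  have h2 : 0 ≤ 2 * u + 4 - b ^ 2 := by linarith
  have : 0 ≤ (1 - u) * (2 * u + 4 - b ^ 2) / g ^ 3 := by positivity
  linarith

lemma WarpedBerger.N_bd (s : WarpedBerger T f g ρ) {c : ℝ} (hc : 0 < c)
    (hcc : 2 * c ^ 5 + 4 * c ^ 4 > 4 / 3)
    (hfg : ∀ ξ t, 0 ≤ t → t < T → f ξ t ≤ g ξ t)
    (hcg : ∀ ξ t, 0 ≤ t → t < T → c * g ξ t ≤ f ξ t)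
    (ha : ∀ ξ t, 0 ≤ t → t < T → Ds ρ f ξ t ^ 2 ≤ 4 / 3) :
    ∃ K, ∀ ξ t, 0 ≤ t → t < T → (f ξ t)⁻¹ - (g ξ t)⁻¹ ≤ K := by
  have hp := s.ρ_pos
  have hN : Gd T (fun ξ t => (f ξ t)⁻¹ - (g ξ t)⁻¹) :=
    ContDiffOn.sub (ContDiffOn.inv s.gf fun p hp => (s.f_pos _ _ hp.2.1 hp.2.2).ne')
      (ContDiffOn.inv s.gg fun p hp => (s.g_pos _ _ hp.2.1 hp.2.2).ne')
  have hP : Per (fun ξ t => (f ξ t)⁻¹ - (g ξ t)⁻¹) := fun ξ t => by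
    simp only [s.f_per ξ t, s.g_per ξ t]
  obtain ⟨K, hK⟩ := hN.bdd s.T_pos hP
  refine ⟨K, ?_⟩
  have main := MP (φ := fun ξ t => ((f ξ t)⁻¹ - (g ξ t)⁻¹) - K) (ContDiffOn.sub hN contDiffOn_const)
    s.gr hp (fun ξ t => by simp only [s.f_per ξ t, s.g_per ξ t]) (fun ξ => by linarith [hK ξ]) ?_
  · intro ξ t h0 h1; linarith [main ξ t h0 h1]
  intro ξ t h0 h1 hpos hs hss
  have hf := s.f_pos ξ t h0.le h1
  have hg := s.g_pos ξ t h0.le h1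
  have e1 : ∀ x, Ds ρ (fun ξ t => ((f ξ t)⁻¹ - (g ξ t)⁻¹) - K) x t
      = -Ds ρ f x t / f x t ^ 2 + Ds ρ g x t / g x t ^ 2 := fun x =>
    Ds_of hp h0.le h1 (((((s.gf.hasDx hp (ξ := x) h0.le h1).inv (s.f_pos x t h0.le h1).ne').sub
      ((s.gg.hasDx hp (ξ := x) h0.le h1).inv (s.g_pos x t h0.le h1).ne')).sub_const K).congr_deriv
        (by ring))
  have e2 : Ds ρ (Ds ρ (fun ξ t => ((f ξ t)⁻¹ - (g ξ t)⁻¹) - K)) ξ t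
      = -Ds ρ (Ds ρ f) ξ t / f ξ t ^ 2 + 2 * Ds ρ f ξ t ^ 2 / f ξ t ^ 3
        + Ds ρ (Ds ρ g) ξ t / g ξ t ^ 2 - 2 * Ds ρ g ξ t ^ 2 / g ξ t ^ 3 := by
    refine Ds_of hp h0.le h1 ?_
    rw [show (fun x => Ds ρ (fun ξ t => ((f ξ t)⁻¹ - (g ξ t)⁻¹) - K) x t) = _ from funext e1]
    refine ((((s.gf.Ds s.gr hp).hasDx hp (ξ := ξ) h0.le h1).neg.div
      ((s.gf.hasDx hp (ξ := ξ) h0.le h1).pow 2) (pow_ne_zero 2 hf.ne')).add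
      (((s.gg.Ds s.gr hp).hasDx hp (ξ := ξ) h0.le h1).div
      ((s.gg.hasDx hp (ξ := ξ) h0.le h1).pow 2) (pow_ne_zero 2 hg.ne'))).congr_deriv ?_
    simp only [Pi.neg_apply, Pi.pow_apply]
    field_simp
    ring
  have e3 : pdt (fun ξ t => ((f ξ t)⁻¹ - (g ξ t)⁻¹) - K) ξ t
      = -pdt f ξ t / f ξ t ^ 2 + pdt g ξ t / g ξ t ^ 2 :=
    (((((s.gf.hasDt (ξ := ξ) h0 h1).inv hf.ne').sub
      ((s.gg.hasDt (ξ := ξ) h0 h1).inv hg.ne')).sub_const K).congr_deriv (by ring)).deriv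
  rw [e1] at hs
  rw [e2] at hss
  rw [e3, s.eq_f ξ t h0 h1, s.eq_g ξ t h0 h1]
  exact alg_N hf hg (hfg ξ t h0.le h1) hc hcc (hcg ξ t h0.le h1) (ha ξ t h0.le h1) hs hss

lemma alg_V {f g a b V N K : ℝ} (hf : 0 < f) (hg : 0 < g) (hfg : f ≤ g)
    (hN : f⁻¹ - g⁻¹ ≤ N) (hK : 4 * N ^ 2 ≤ K) (hV : K < V ^ 2) :
    V * (-(a ^ 2 / f ^ 2 + 2 * b ^ 2 / g ^ 2 + 8 * f ^ 2 / g ^ 4) * V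
      - 8 * (g ^ 2 - f ^ 2) * b / g ^ 5) ≤ 0 := by
  have e : V * (-(a ^ 2 / f ^ 2 + 2 * b ^ 2 / g ^ 2 + 8 * f ^ 2 / g ^ 4) * V
      - 8 * (g ^ 2 - f ^ 2) * b / g ^ 5)
      = -((a * V / f) ^ 2 + 2 * (b * V / g + 2 * (g ^ 2 - f ^ 2) / g ^ 4) ^ 2
        + 8 / g ^ 8 * ((f * g ^ 2 * V) ^ 2 - (g ^ 2 - f ^ 2) ^ 2)) := by
    field_simp; ring
  rw [e]
  have h1 : g - f ≤ N * (f * g) := by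
    have := mul_le_mul_of_nonneg_right hN (by positivity : 0 ≤ f * g)
    have e : (f⁻¹ - g⁻¹) * (f * g) = g - f := by field_simp
    linarith
  have h0 : 0 ≤ N * (f * g) := by linarith
  have h2 : (g ^ 2 - f ^ 2) ^ 2 ≤ (2 * N * (f * g ^ 2)) ^ 2 := by
    have : 0 ≤ g ^ 2 - f ^ 2 := by nlinarith
    gcongr
    nlinarith
  have h3 : (2 * N * (f * g ^ 2)) ^ 2 ≤ (f * g ^ 2 * V) ^ 2 := by
    have : 0 < (f * g ^ 2) ^ 2 := by positivity
    nlinarith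
  have h4 : 0 ≤ 8 / g ^ 8 * ((f * g ^ 2 * V) ^ 2 - (g ^ 2 - f ^ 2) ^ 2) :=
    mul_nonneg (by positivity) (by linarith)
  nlinarith [sq_nonneg (a * V / f), sq_nonneg (b * V / g + 2 * (g ^ 2 - f ^ 2) / g ^ 4)]

lemma WarpedBerger.V_bd (s : WarpedBerger T f g ρ) {N : ℝ}
    (hfg : ∀ ξ t, 0 ≤ t → t < T → f ξ t ≤ g ξ t)
    (hN : ∀ ξ t, 0 ≤ t → t < T → (f ξ t)⁻¹ - (g ξ t)⁻¹ ≤ N) :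
    ∃ K, ∀ ξ t, 0 ≤ t → t < T → Ds ρ (ww f g) ξ t ^ 2 ≤ K := by
  have hG := s.gw.Ds s.gr s.ρ_pos
  have hP : Per (Ds ρ (ww f g)) := Per.Ds s.pw s.ρ_per
  obtain ⟨K, hK⟩ := hG.bddsq s.T_pos hP
  refine ⟨max (4 * N ^ 2) K, MPsq (max (4 * N ^ 2) K) hG s.gr s.ρ_pos hP
    (le_trans (by positivity) (le_max_left _ _)) (fun ξ => (hK ξ).trans (le_max_right _ _)) ?_⟩
  intro ξ t h0 h1 hpos hs hss
  rw [s.evo_V h0 h1, hs]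
  have := alg_V (a := Ds ρ f ξ t) (b := Ds ρ g ξ t) (s.f_pos ξ t h0.le h1) (s.g_pos ξ t h0.le h1)
    (hfg ξ t h0.le h1) (hN ξ t h0.le h1) (le_max_left _ K) hpos
  linarith

end evo

/-- Under Assumption B there is a uniform constant `C` such that
`|f_s − g_s| ≤ C·M` for as long as the solution exists. -/
theorem sharper_C1_estimate (T : ℝ) (f g ρ : ℝ → ℝ → ℝ)
    (sol : AssumptionB T f g ρ) :
    ∃ C : ℝ, ∀ ξ t : ℝ, 0 ≤ t → t < T →
      |Ds ρ f ξ t - Ds ρ g ξ t| ≤ C * M f g ξ t := by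
  have s : WarpedBerger T f g ρ := sol.toAssumptionA.toWarpedBerger
  obtain ⟨ε, hε0, hε1, hεc, hpi⟩ := sol.init_pinched
  have hfg := s.ord sol.init_order
  have hcg := s.pinch (by linarith) (by linarith) hpi
  have hA := s.fs_bd hfg sol.init_fs
  obtain ⟨B, hB⟩ := s.gs_bd hfg
  obtain ⟨N, hN⟩ := s.N_bd (by linarith) hεc hfg hcg hA
  obtain ⟨K, hK⟩ := s.V_bd hfg hN
  refine ⟨√K + √B * N, fun ξ t h0 h1 => ?_⟩
  have hf := s.f_pos ξ t h0 h1
  have hg := s.g_pos ξ t h0 h1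
  have hM : M f g ξ t = f ξ t := min_eq_left (hfg ξ t h0 h1)
  have e : Ds ρ f ξ t - Ds ρ g ξ t
      = f ξ t * Ds ρ (ww f g) ξ t - Ds ρ g ξ t * (f ξ t * ((f ξ t)⁻¹ - (g ξ t)⁻¹)) := by
    rw [s.ws ξ h0 h1]
    field_simp
    ring
  have h2 : 0 ≤ (f ξ t)⁻¹ - (g ξ t)⁻¹ :=
    sub_nonneg.2 (inv_anti₀ hf (hfg ξ t h0 h1))
  have hV := Real.abs_le_sqrt (hK ξ t h0 h1)
  have hb := Real.abs_le_sqrt (hB ξ t h0 h1)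
  rw [hM, e]
  refine (abs_sub _ _).trans ?_
  rw [abs_mul, abs_mul, abs_of_pos hf, abs_of_nonneg (by positivity : 0 ≤ f ξ t * ((f ξ t)⁻¹ - (g ξ t)⁻¹))]
  have h3 : f ξ t * |Ds ρ (ww f g) ξ t| ≤ f ξ t * √K := by gcongr
  have h4 : |Ds ρ g ξ t| * (f ξ t * ((f ξ t)⁻¹ - (g ξ t)⁻¹)) ≤ √B * (f ξ t * N) := by
    have := hN ξ t h0 h1
    gcongr
  nlinarith
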